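/- arXiv:1802.03616 — 2 statements merged into one kernel-verified Lean document; each statement's English description precedes it below -/
import Mathlib

section
/- Let Λ = {Λ_ω ∈ B(H,E) : ω ∈ Ω} and Θ = {Θ_ω ∈ B(K,E) : ω ∈ Ω} be continuous g-frames for H and for K, both with respect to E, and define Γ_ω(h ⊕ k) = Λ_ω h + Θ_ω k on the Hilbert direct sum H ⊕ K. Then Λ and Θ are disjoint if and only if Γ = {Γ_ω : ω ∈ Ω} is a continuous g-frame for H ⊕ K with respect to E. -/
open MeasureTheory
open scoped ENNReal NNReal Pointwise

noncomputable section

local notation "⟪" x ", " y "⟫" => @inner ℂ _ _ x y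

variable {Ω : Type*} [MeasurableSpace Ω]

section Defs

variable {F G E : Type*}
  [NormedAddCommGroup F] [InnerProductSpace ℂ F]
  [NormedAddCommGroup G] [InnerProductSpace ℂ G]
  [NormedAddCommGroup E] [InnerProductSpace ℂ E]

/-- `Λ` is a continuous g-frame for `F` with respect to `E`, with frame bounds `A`, `B`:
for every `f`, `ω ↦ Λ ω f` is strongly measurable and
`A‖f‖² ≤ ∫ ‖Λ ω f‖² dμ(ω) ≤ B‖f‖²`. -/
def IsCgFrame (μ : Measure Ω) (Λ : Ω → F →L[ℂ] E) (A B : ℝ) : Prop :=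
  (∀ f : F, StronglyMeasurable fun ω => Λ ω f) ∧
    ∀ f : F,
      ENNReal.ofReal (A * ‖f‖ ^ 2) ≤ ∫⁻ ω, (‖Λ ω f‖₊ : ℝ≥0∞) ^ 2 ∂μ ∧
        ∫⁻ ω, (‖Λ ω f‖₊ : ℝ≥0∞) ^ 2 ∂μ ≤ ENNReal.ofReal (B * ‖f‖ ^ 2)

/-- `Λ` is a continuous g-Bessel family with Bessel constant `B`. -/
def IsCgBessel (μ : Measure Ω) (Λ : Ω → F →L[ℂ] E) (B : ℝ) : Prop :=
  (∀ f : F, StronglyMeasurable fun ω => Λ ω f) ∧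
    ∀ f : F, ∫⁻ ω, (‖Λ ω f‖₊ : ℝ≥0∞) ^ 2 ∂μ ≤ ENNReal.ofReal (B * ‖f‖ ^ 2)

/-- `Λ` is a tight continuous g-frame with bound `A`. -/
def IsCgTight (μ : Measure Ω) (Λ : Ω → F →L[ℂ] E) (A : ℝ) : Prop :=
  (∀ f : F, StronglyMeasurable fun ω => Λ ω f) ∧
    ∀ f : F, ∫⁻ ω, (‖Λ ω f‖₊ : ℝ≥0∞) ^ 2 ∂μ = ENNReal.ofReal (A * ‖f‖ ^ 2)

/-- `Λ` is a Parseval continuous g-frame. -/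
def IsCgParseval (μ : Measure Ω) (Λ : Ω → F →L[ℂ] E) : Prop :=
  (∀ f : F, StronglyMeasurable fun ω => Λ ω f) ∧
    ∀ f : F, ∫⁻ ω, (‖Λ ω f‖₊ : ℝ≥0∞) ^ 2 ∂μ = ENNReal.ofReal (‖f‖ ^ 2)

/-- The range of the analysis operator `T*_Λ : F → Ê = L²(Ω,μ;E)`, i.e. the set of elements of
`L²(Ω,μ;E)` represented by `ω ↦ Λ ω f` for some `f : F`. -/
def analysisRange (μ : Measure Ω) (Λ : Ω → F →L[ℂ] E) : Set (Lp E 2 μ) :=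
  {φ | ∃ f : F, (fun ω => Λ ω f) =ᵐ[μ] (φ : Ω → E)}

/-- `Λ` and `Θ` are strongly disjoint: the ranges of their analysis operators are orthogonal,
equivalently `∫ ⟨Λ ω h, Θ ω k⟩ dμ(ω) = 0` for all `h`, `k`. -/
def StronglyDisjoint (μ : Measure Ω) (Λ : Ω → F →L[ℂ] E) (Θ : Ω → G →L[ℂ] E) : Prop :=
  ∀ (h : F) (k : G), ∫ ω, ⟪Λ ω h, Θ ω k⟫ ∂μ = 0

/-- `Λ` and `Θ` are disjoint: `Range T*_Λ ∩ Range T*_Θ = {0}` and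
`Range T*_Λ + Range T*_Θ` is closed in `Ê`. -/
def IsDisjoint (μ : Measure Ω) (Λ : Ω → F →L[ℂ] E) (Θ : Ω → G →L[ℂ] E) : Prop :=
  analysisRange μ Λ ∩ analysisRange μ Θ = {(0 : Lp E 2 μ)} ∧
    IsClosed (analysisRange μ Λ + analysisRange μ Θ)

/-- `Λ` and `Θ` are weakly disjoint: `Range T*_Λ ∩ Range T*_Θ = {0}`. -/
def WeaklyDisjoint (μ : Measure Ω) (Λ : Ω → F →L[ℂ] E) (Θ : Ω → G →L[ℂ] E) : Prop :=
  analysisRange μ Λ ∩ analysisRange μ Θ = {(0 : Lp E 2 μ)}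

/-- `Λ` and `Θ` are a complementary pair: `Range T*_Λ ∩ Range T*_Θ = {0}` and
`Range T*_Λ + Range T*_Θ = Ê`. -/
def ComplementaryPair (μ : Measure Ω) (Λ : Ω → F →L[ℂ] E) (Θ : Ω → G →L[ℂ] E) : Prop :=
  analysisRange μ Λ ∩ analysisRange μ Θ = {(0 : Lp E 2 μ)} ∧
    analysisRange μ Λ + analysisRange μ Θ = (Set.univ : Set (Lp E 2 μ))

/-- `Λ` and `Θ` are a strongly complementary pair: `Ê` is the orthogonal direct sum of
`Range T*_Λ` and `Range T*_Θ`. -/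
def StronglyComplementaryPair (μ : Measure Ω) (Λ : Ω → F →L[ℂ] E) (Θ : Ω → G →L[ℂ] E) : Prop :=
  StronglyDisjoint μ Λ Θ ∧
    analysisRange μ Λ + analysisRange μ Θ = (Set.univ : Set (Lp E 2 μ))

/-- `S` is the (continuous g-)frame operator of `Λ`:
`⟨S f, g⟩ = ∫ ⟨Λ ω f, Λ ω g⟩ dμ(ω)`. -/
def IsFrameOperator (μ : Measure Ω) (Λ : Ω → F →L[ℂ] E) (S : F →L[ℂ] F) : Prop :=
  ∀ f g : F, ⟪S f, g⟫ = ∫ ω, ⟪Λ ω f, Λ ω g⟫ ∂μ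

/-- `Θ` is a dual of `Λ`: `∫ ⟨Θ ω f, Λ ω g⟩ dμ(ω) = ⟨f, g⟩` for all `f`, `g`. -/
def IsDualOf (μ : Measure Ω) (Θ Λ : Ω → F →L[ℂ] E) : Prop :=
  ∀ f g : F, ∫ ω, ⟪Θ ω f, Λ ω g⟫ ∂μ = ⟪f, g⟫

/-- `Λ` is a Riesz-type continuous g-frame: it is a continuous g-frame and every dual of `Λ`
is weakly equal to the canonical dual `{Λ_ω S_Λ⁻¹}`, where `S_Λ` is the frame operator. -/
def IsRieszType (μ : Measure Ω) (Λ : Ω → F →L[ℂ] E) : Prop :=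
  (∃ A B : ℝ, 0 < A ∧ IsCgFrame μ Λ A B) ∧
    ∀ S : F ≃L[ℂ] F, IsFrameOperator μ Λ (S : F →L[ℂ] F) →
      ∀ Θ : Ω → F →L[ℂ] E, (∃ A B : ℝ, 0 < A ∧ IsCgFrame μ Θ A B) → IsDualOf μ Θ Λ →
        ∀ f : F, ∀ᵐ ω ∂μ, Θ ω f = Λ ω (S.symm f)

/-- The operator `h ⊕ k ↦ Λω h + Θω k` on the Hilbert direct sum `F ⊕ G = WithLp 2 (F × G)`. -/
def pairMap (Λω : F →L[ℂ] E) (Θω : G →L[ℂ] E) : WithLp 2 (F × G) →L[ℂ] E :=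
  (Λω.comp (ContinuousLinearMap.fst ℂ F G) + Θω.comp (ContinuousLinearMap.snd ℂ F G)).comp
    (WithLp.prodContinuousLinearEquiv 2 ℂ F G).toContinuousLinearMap

end Defs

theorem lintegral_nnnorm_sq_eq_of_ae_eq {E : Type*} [NormedAddCommGroup E]
    {μ : Measure Ω} {g : Ω → E} {φ : Lp E 2 μ}
    (h : (φ : Ω → E) =ᵐ[μ] g) :
    ∫⁻ ω, (‖g ω‖₊ : ℝ≥0∞) ^ 2 ∂μ = ENNReal.ofReal (‖φ‖ ^ 2) := by
  have h1 : ENNReal.ofReal ‖φ‖ = eLpNorm g 2 μ := by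
    rw [Lp.norm_def, ENNReal.ofReal_toReal (Lp.eLpNorm_ne_top φ), eLpNorm_congr_ae h]
  rw [ENNReal.ofReal_pow (norm_nonneg _), h1]
  have := eLpNorm_nnreal_pow_eq_lintegral (μ := μ) (f := g) (p := 2) (by norm_num)
  simpa [enorm_eq_nnnorm] using this.symm

section AnalysisOperator

variable {F G E : Type*}
  [NormedAddCommGroup F] [InnerProductSpace ℂ F]
  [NormedAddCommGroup G] [InnerProductSpace ℂ G]
  [NormedAddCommGroup E] [InnerProductSpace ℂ E]

theorem IsCgFrame.isCgBessel {μ : Measure Ω} {Λ : Ω → F →L[ℂ] E} {A B : ℝ}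
    (h : IsCgFrame μ Λ A B) : IsCgBessel μ Λ B :=
  ⟨h.1, fun f => (h.2 f).2⟩

theorem IsCgBessel.memLp {μ : Measure Ω} {Λ : Ω → F →L[ℂ] E} {B : ℝ}
    (h : IsCgBessel μ Λ B) (f : F) : MemLp (fun ω => Λ ω f) 2 μ := by
  refine ⟨(h.1 f).aestronglyMeasurable, ?_⟩
  have h2 := eLpNorm_nnreal_pow_eq_lintegral (μ := μ) (f := fun ω => Λ ω f) (p := 2) (by norm_num)
  have h3 : eLpNorm (fun ω => Λ ω f) 2 μ ^ 2 < ⊤ := by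
    refine lt_of_eq_of_lt ?_ ((h.2 f).trans_lt ENNReal.ofReal_lt_top)
    simpa [enorm_eq_nnnorm] using h2
  simpa using h3

/-- The analysis operator of a continuous g-Bessel family. -/
theorem IsCgBessel.exists_analysis {μ : Measure Ω} {Λ : Ω → F →L[ℂ] E} {B : ℝ}
    (h : IsCgBessel μ Λ B) :
    ∃ T : F →L[ℂ] Lp E 2 μ, ∀ f, (T f : Ω → E) =ᵐ[μ] fun ω => Λ ω f := by
  let T : F →ₗ[ℂ] Lp E 2 μ :=
    { toFun := fun f => (h.memLp f).toLp
      map_add' := fun f g => by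
        rw [← MemLp.toLp_add]
        congr 1
        ext ω
        simp
      map_smul' := fun c f => by
        rw [RingHom.id_apply, ← MemLp.toLp_const_smul]
        congr 1
        ext ω
        simp }
  have hT : ∀ f, (T f : Ω → E) =ᵐ[μ] fun ω => Λ ω f := fun f => (h.memLp f).coeFn_toLp
  refine ⟨T.mkContinuous √(max B 0) fun f => ?_, hT⟩
  have h1 : ‖T f‖ ^ 2 ≤ max B 0 * ‖f‖ ^ 2 := by
    rw [← ENNReal.ofReal_le_ofReal_iff (by positivity), ← lintegral_nnnorm_sq_eq_of_ae_eq (hT f)]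
    refine (h.2 f).trans (ENNReal.ofReal_le_ofReal ?_)
    gcongr
    exact le_max_left _ _
  refine le_of_sq_le_sq ?_ (by positivity)
  rwa [mul_pow, Real.sq_sqrt (le_max_right _ _)]

theorem analysisRange_eq_range {μ : Measure Ω} {Λ : Ω → F →L[ℂ] E} {T : F →L[ℂ] Lp E 2 μ}
    (hT : ∀ f, (T f : Ω → E) =ᵐ[μ] fun ω => Λ ω f) :
    analysisRange μ Λ = Set.range T := by
  ext φ
  refine exists_congr fun f => ⟨fun h => Lp.ext ((hT f).trans h), ?_⟩
  rintro rfl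
  exact (hT f).symm

theorem IsCgFrame.norm_sq_le {μ : Measure Ω} {Λ : Ω → F →L[ℂ] E} {A B : ℝ}
    (h : IsCgFrame μ Λ A B) {T : F →L[ℂ] Lp E 2 μ}
    (hT : ∀ f, (T f : Ω → E) =ᵐ[μ] fun ω => Λ ω f) (f : F) :
    A * ‖f‖ ^ 2 ≤ ‖T f‖ ^ 2 := by
  rw [← ENNReal.ofReal_le_ofReal_iff (by positivity), ← lintegral_nnnorm_sq_eq_of_ae_eq (hT f)]
  exact (h.2 f).1

theorem IsCgFrame.antilipschitz {μ : Measure Ω} {Λ : Ω → F →L[ℂ] E} {A B : ℝ} (hA : 0 < A)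
    (h : IsCgFrame μ Λ A B) {T : F →L[ℂ] Lp E 2 μ}
    (hT : ∀ f, (T f : Ω → E) =ᵐ[μ] fun ω => Λ ω f) :
    ∃ c, AntilipschitzWith c T := by
  refine ⟨(Real.toNNReal √A)⁻¹, T.antilipschitz_of_bound fun f => ?_⟩
  have hs : 0 < √A := Real.sqrt_pos.2 hA
  rw [NNReal.coe_inv, Real.coe_toNNReal _ hs.le, inv_mul_eq_div, le_div_iff₀ hs]
  refine le_of_sq_le_sq ?_ (norm_nonneg _)
  rw [mul_pow, Real.sq_sqrt hA.le, mul_comm]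
  exact h.norm_sq_le hT f

theorem isCgFrame_of_antilipschitz {μ : Measure Ω} {Λ : Ω → F →L[ℂ] E}
    (hm : ∀ f : F, StronglyMeasurable fun ω => Λ ω f) {T : F →L[ℂ] Lp E 2 μ}
    (hT : ∀ f, (T f : Ω → E) =ᵐ[μ] fun ω => Λ ω f) {c : ℝ≥0} (hc : AntilipschitzWith c T) :
    ∃ A B : ℝ, 0 < A ∧ IsCgFrame μ Λ A B := by
  refine ⟨(((c : ℝ) + 1) ^ 2)⁻¹, ‖T‖ ^ 2, by positivity, hm, fun f => ?_⟩
  rw [lintegral_nnnorm_sq_eq_of_ae_eq (hT f)]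
  constructor
  · refine ENNReal.ofReal_le_ofReal ?_
    rw [inv_mul_le_iff₀ (by positivity), ← mul_pow]
    have h1 : ‖f‖ ≤ c * ‖T f‖ := by simpa using hc.le_mul_dist f 0
    gcongr
    linarith [norm_nonneg (T f)]
  · refine ENNReal.ofReal_le_ofReal ?_
    rw [← mul_pow]
    gcongr
    exact T.le_opNorm f

theorem pairMap_apply (S : F →L[ℂ] E) (T : G →L[ℂ] E) (x : WithLp 2 (F × G)) :
    pairMap S T x = S x.fst + T x.snd := rfl

theorem pairMap_coeFn_ae_eq {μ : Measure Ω} {Λ : Ω → F →L[ℂ] E} {Θ : Ω → G →L[ℂ] E}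
    {S : F →L[ℂ] Lp E 2 μ} {T : G →L[ℂ] Lp E 2 μ}
    (hS : ∀ f, (S f : Ω → E) =ᵐ[μ] fun ω => Λ ω f)
    (hT : ∀ g, (T g : Ω → E) =ᵐ[μ] fun ω => Θ ω g) (x : WithLp 2 (F × G)) :
    ((S x.fst + T x.snd : Lp E 2 μ) : Ω → E) =ᵐ[μ] fun ω => pairMap (Λ ω) (Θ ω) x := by
  filter_upwards [Lp.coeFn_add (S x.fst) (T x.snd), hS x.fst, hT x.snd] with ω h1 h2 h3
  rw [h1, Pi.add_apply, h2, h3, pairMap_apply]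

theorem range_pairMap (S : F →L[ℂ] E) (T : G →L[ℂ] E) :
    Set.range (pairMap S T) = Set.range S + Set.range T := by
  ext y
  rw [Set.mem_add]
  constructor
  · rintro ⟨x, rfl⟩
    exact ⟨_, ⟨x.fst, rfl⟩, _, ⟨x.snd, rfl⟩, rfl⟩
  · rintro ⟨_, ⟨f, rfl⟩, _, ⟨g, rfl⟩, rfl⟩
    exact ⟨WithLp.toLp 2 (f, g), rfl⟩

theorem injective_pairMap_iff {S : F →L[ℂ] E} {T : G →L[ℂ] E}
    (hS : Function.Injective S) (hT : Function.Injective T) :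
    Function.Injective (pairMap S T) ↔ Set.range S ∩ Set.range T = {0} := by
  rw [injective_iff_map_eq_zero]
  constructor
  · intro h
    refine Set.eq_singleton_iff_unique_mem.2 ⟨⟨⟨0, map_zero S⟩, ⟨0, map_zero T⟩⟩, ?_⟩
    rintro _ ⟨⟨f, rfl⟩, ⟨g, hg⟩⟩
    have h0 := h (WithLp.toLp 2 (f, -g)) (by simp [pairMap_apply, hg])
    have hf : f = 0 := congrArg WithLp.fst h0
    rw [hf, map_zero]
  · intro h x hx
    rw [pairMap_apply] at hx
    have h1 : S x.fst ∈ Set.range S ∩ Set.range T :=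
      ⟨⟨_, rfl⟩, -x.snd, by rw [map_neg, eq_neg_of_add_eq_zero_left hx]⟩
    rw [h, Set.mem_singleton_iff] at h1
    rw [h1, zero_add] at hx
    have hf : x.fst = 0 := hS (h1.trans (map_zero S).symm)
    have hg : x.snd = 0 := hT (hx.trans (map_zero T).symm)
    exact WithLp.ofLp_injective 2 (Prod.ext hf hg)

end AnalysisOperator

variable {H K E : Type*}
  [NormedAddCommGroup H] [InnerProductSpace ℂ H] [CompleteSpace H]
  [NormedAddCommGroup K] [InnerProductSpace ℂ K] [CompleteSpace K]
  [NormedAddCommGroup E] [InnerProductSpace ℂ E] [CompleteSpace E]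

/-- `Λ` and `Θ` are disjoint iff `Γ`, `Γ_ω (h ⊕ k) = Λ_ω h + Θ_ω k`,
is a continuous g-frame for `H ⊕ K`. -/
theorem stmt1 (μ : Measure Ω) (Λ : Ω → H →L[ℂ] E) (Θ : Ω → K →L[ℂ] E)
    (AL BL AT BT : ℝ) (hAL : 0 < AL) (hAT : 0 < AT)
    (hL : IsCgFrame μ Λ AL BL) (hT : IsCgFrame μ Θ AT BT) :
    IsDisjoint μ Λ Θ ↔
      ∃ A B : ℝ, 0 < A ∧ IsCgFrame μ (fun ω => pairMap (Λ ω) (Θ ω)) A B := by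
  obtain ⟨S, hS⟩ := hL.isCgBessel.exists_analysis
  obtain ⟨T, hT'⟩ := hT.isCgBessel.exists_analysis
  obtain ⟨_, hSa⟩ := hL.antilipschitz hAL hS
  obtain ⟨_, hTa⟩ := hT.antilipschitz hAT hT'
  have hP : ∀ x, (pairMap S T x : Ω → E) =ᵐ[μ] fun ω => pairMap (Λ ω) (Θ ω) x :=
    pairMap_coeFn_ae_eq hS hT'
  rw [IsDisjoint, analysisRange_eq_range hS, analysisRange_eq_range hT', ← range_pairMap,
    ← injective_pairMap_iff hSa.injective hTa.injective]
  constructor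
  · rintro ⟨hinj, hcl⟩
    obtain ⟨c, hc⟩ := (pairMap S T).antilipschitz_of_injective_of_isClosed_range hinj hcl
    exact isCgFrame_of_antilipschitz (fun x => (hL.1 x.fst).add (hT.1 x.snd)) hP hc
  · rintro ⟨A, B, hA, h⟩
    obtain ⟨c, hc⟩ := h.antilipschitz hA hP
    exact ⟨hc.injective, hc.isClosed_range (pairMap S T).uniformContinuous⟩
end
end

section
/- Let Λ = {Λ_ω ∈ B(H,E) : ω ∈ Ω} and Θ = {Θ_ω ∈ B(H,E) : ω ∈ Ω} be continuous g-Bessel families for H with respect to E, with Bessel constants B_Λ, B_Θ, such that ∫_Ω ⟨Θ_ω f, Λ_ω g⟩ dμ(ω) = ⟨f, g⟩ for all f, g ∈ H (i.e. S_ΛΘ = I_H). Let L₁, L₂ ∈ B(H) satisfy L₁* L₂ = I. Then {Λ_ω L₁ + Θ_ω L₂ : ω ∈ Ω} is a continuous g-frame for H; more precisely, 2‖f‖² ≤ ∫_Ω ‖(Λ_ω L₁ + Θ_ω L₂)f‖² dμ(ω) ≤ (B_Λ‖L₁‖² + 2 + B_Θ‖L₂‖²)‖f‖² for all f ∈ H.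 -/
open MeasureTheory
open scoped ENNReal NNReal Pointwise

noncomputable section

local notation "⟪" x ", " y "⟫" => @inner ℂ _ _ x y

variable {Ω : Type*} [MeasurableSpace Ω]

theorem lintegral_nnnorm_sq_eq_ofReal_integral {E : Type*} [NormedAddCommGroup E] {μ : Measure Ω}
    {u : Ω → E} (hu : MemLp u 2 μ) :
    ∫⁻ ω, (‖u ω‖₊ : ℝ≥0∞) ^ 2 ∂μ = ENNReal.ofReal (∫ ω, ‖u ω‖ ^ 2 ∂μ) := by
  rw [ofReal_integral_eq_lintegral_ofReal (by simpa using hu.integrable_norm_pow (by simp))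
    (Filter.Eventually.of_forall fun ω => by positivity)]
  congr with ω
  rw [ENNReal.ofReal_pow (norm_nonneg _), ofReal_norm, enorm_eq_nnnorm]

theorem memLp_two_of_lintegral_nnnorm_sq_lt_top {E : Type*} [NormedAddCommGroup E] {μ : Measure Ω}
    {u : Ω → E} (hu : AEStronglyMeasurable u μ)
    (h : ∫⁻ ω, (‖u ω‖₊ : ℝ≥0∞) ^ 2 ∂μ < ∞) : MemLp u 2 μ := by
  refine ⟨hu, ?_⟩
  rw [eLpNorm_lt_top_iff_lintegral_rpow_enorm_lt_top (by simp) (by simp)]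
  simpa [enorm_eq_nnnorm] using h

theorem integral_norm_add_sq_of_memLp_two {E : Type*} [NormedAddCommGroup E]
    [InnerProductSpace ℂ E] {μ : Measure Ω} {u v : Ω → E}
    (hu : MemLp u 2 μ) (hv : MemLp v 2 μ) :
    ∫ ω, ‖u ω + v ω‖ ^ 2 ∂μ =
      ∫ ω, ‖u ω‖ ^ 2 ∂μ + 2 * (∫ ω, inner ℂ (v ω) (u ω) ∂μ).re + ∫ ω, ‖v ω‖ ^ 2 ∂μ := by
  have hu2 : Integrable (fun ω => ‖u ω‖ ^ 2) μ := by
    simpa using hu.integrable_norm_pow (by simp)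
  have hv2 : Integrable (fun ω => ‖v ω‖ ^ 2) μ := by
    simpa using hv.integrable_norm_pow (by simp)
  have huv : Integrable (fun ω => inner ℂ (v ω) (u ω)) μ := by
    refine Integrable.mono' (hu2.add hv2)
      (hv.aestronglyMeasurable.inner hu.aestronglyMeasurable)
      (Filter.Eventually.of_forall fun ω => ?_)
    have := norm_inner_le_norm (𝕜 := ℂ) (v ω) (u ω)
    simp only [Pi.add_apply]
    nlinarith [sq_nonneg (‖u ω‖ - ‖v ω‖), sq_nonneg (‖u ω‖ + ‖v ω‖)]
  have hre : ∫ ω, (inner ℂ (v ω) (u ω)).re ∂μ = (∫ ω, inner ℂ (v ω) (u ω) ∂μ).re :=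
    integral_re huv
  have h_re_int : Integrable (fun ω => 2 * (inner ℂ (v ω) (u ω)).re) μ := huv.re.const_mul 2
  rw [← hre, ← integral_const_mul, ← integral_add hu2 h_re_int,
    ← integral_add (by exact hu2.add h_re_int) hv2]
  congr with ω
  rw [norm_add_sq (𝕜 := ℂ), inner_re_symm]
  rfl

namespace IsCgBessel

variable {F E : Type*} [NormedAddCommGroup F] [InnerProductSpace ℂ F]
  [NormedAddCommGroup E] [InnerProductSpace ℂ E] {μ : Measure Ω} {Λ : Ω → F →L[ℂ] E} {B : ℝ}

theorem memLp_s15 (h : IsCgBessel μ Λ B) (f : F) : MemLp (fun ω => Λ ω f) 2 μ :=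
  memLp_two_of_lintegral_nnnorm_sq_lt_top (h.1 f).aestronglyMeasurable
    ((h.2 f).trans_lt ENNReal.ofReal_lt_top)

theorem integral_le (h : IsCgBessel μ Λ B) (hB : 0 ≤ B) (f : F) :
    ∫ ω, ‖Λ ω f‖ ^ 2 ∂μ ≤ B * ‖f‖ ^ 2 := by
  have := h.2 f
  rwa [lintegral_nnnorm_sq_eq_ofReal_integral (h.memLp_s15 f),
    ENNReal.ofReal_le_ofReal_iff (by positivity)] at this

theorem integral_comp_le (h : IsCgBessel μ Λ B) (hB : 0 ≤ B) (L : F →L[ℂ] F) (f : F) :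
    ∫ ω, ‖Λ ω (L f)‖ ^ 2 ∂μ ≤ B * ‖L‖ ^ 2 * ‖f‖ ^ 2 := by
  refine (h.integral_le hB (L f)).trans ?_
  rw [mul_assoc, ← mul_pow]
  gcongr
  exact L.le_opNorm f

end IsCgBessel

variable {H K E : Type*}
  [NormedAddCommGroup H] [InnerProductSpace ℂ H] [CompleteSpace H]
  [NormedAddCommGroup K] [InnerProductSpace ℂ K] [CompleteSpace K]
  [NormedAddCommGroup E] [InnerProductSpace ℂ E] [CompleteSpace E]

/-- if `Λ`, `Θ` are continuous g-Bessel families with `S_ΛΘ = I` and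
`L₁* L₂ = I`, then `{Λ_ω L₁ + Θ_ω L₂}` is a continuous g-frame with bounds `2` and
`B_Λ‖L₁‖² + 2 + B_Θ‖L₂‖²`. -/
theorem stmt15 (μ : Measure Ω) (Λ Θ : Ω → H →L[ℂ] E)
    (BL BT : ℝ) (hBL : 0 < BL) (hBT : 0 < BT)
    (hL : IsCgBessel μ Λ BL) (hT : IsCgBessel μ Θ BT)
    (hdual : ∀ f g : H, ∫ ω, ⟪Θ ω f, Λ ω g⟫ ∂μ = ⟪f, g⟫)
    (L₁ L₂ : H →L[ℂ] H)
    (hL12 : (ContinuousLinearMap.adjoint L₁).comp L₂ = ContinuousLinearMap.id ℂ H) :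
    IsCgFrame μ (fun ω => (Λ ω).comp L₁ + (Θ ω).comp L₂)
      2 (BL * ‖L₁‖ ^ 2 + 2 + BT * ‖L₂‖ ^ 2) := by
  refine ⟨fun f => (hL.1 (L₁ f)).add (hT.1 (L₂ f)), fun f => ?_⟩
  have hu := hL.memLp_s15 (L₁ f)
  have hv := hT.memLp_s15 (L₂ f)
  have hinner : ⟪L₂ f, L₁ f⟫ = (‖f‖ : ℂ) ^ 2 := by
    rw [← ContinuousLinearMap.adjoint_inner_left, ← ContinuousLinearMap.comp_apply, hL12]
    exact inner_self_eq_norm_sq_to_K f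
  have hexp := integral_norm_add_sq_of_memLp_two hu hv
  rw [hdual, hinner, ← Complex.ofReal_pow, Complex.ofReal_re] at hexp
  have h₁ := hL.integral_comp_le hBL.le L₁ f
  have h₂ := hT.integral_comp_le hBT.le L₂ f
  have h₁' : 0 ≤ ∫ ω, ‖Λ ω (L₁ f)‖ ^ 2 ∂μ := integral_nonneg fun _ => sq_nonneg _
  have h₂' : 0 ≤ ∫ ω, ‖Θ ω (L₂ f)‖ ^ 2 ∂μ := integral_nonneg fun _ => sq_nonneg _
  have key : ∫⁻ ω, (‖((Λ ω).comp L₁ + (Θ ω).comp L₂) f‖₊ : ℝ≥0∞) ^ 2 ∂μ =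
      ENNReal.ofReal (∫ ω, ‖Λ ω (L₁ f) + Θ ω (L₂ f)‖ ^ 2 ∂μ) :=
    lintegral_nnnorm_sq_eq_ofReal_integral (hu.add hv)
  rw [key, hexp]
  constructor <;> apply ENNReal.ofReal_le_ofReal <;> linarith
end
end
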